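/- Let A be a Nakayama algebra and T a torsion class in A-mod. Define α(T) = { X ∈ T : for every morphism g : Y → X with Y ∈ T, ker(g) ∈ T }. Then α(T) equals the a priori larger class obtained by testing only morphisms g : Y → X with Y indecomposable in T. -/

import Mathlib

noncomputable section
open Function

/-- A module is uniserial if its submodules are totally ordered by inclusion. -/
def IsUniserial (A : Type) [Ring A] (M : Type) [AddCommGroup M] [Module A M] : Prop :=
  ∀ U V : Submodule A M, U ≤ V ∨ V ≤ U

/-- An indecomposable module: nonzero, and every direct sum decomposition is trivial. -/
def Indec (A : Type) [Ring A] (M : Type) [AddCommGroup M] [Module A M] : Prop :=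
  Nontrivial M ∧ ∀ X Y : ModuleCat.{0} A, Nonempty (M ≃ₗ[A] (↑X × ↑Y)) →
    Subsingleton X ∨ Subsingleton Y

/-- A ring is a Nakayama algebra if every finitely generated indecomposable projective
module and every finitely generated indecomposable injective module is uniserial. -/
def IsNakayamaAlgebra (A : Type) [Ring A] : Prop :=
  (∀ P : ModuleCat.{0} A, Module.Finite A P → Module.Projective A P → Indec A P →
    IsUniserial A P) ∧
  (∀ Q : ModuleCat.{0} A, Module.Finite A Q → Module.Injective A Q → Indec A Q →
    IsUniserial A Q)

/-- A class of modules is closed under isomorphism. -/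
def RespIso (A : Type) [Ring A] (C : ModuleCat.{0} A → Prop) : Prop :=
  ∀ X Y : ModuleCat.{0} A, Nonempty (↑X ≃ₗ[A] ↑Y) → C X → C Y

/-- A wide subcategory of the category of finitely generated `A`-modules: an
isomorphism-closed class of finitely generated modules closed under kernels, cokernels
and extensions. -/
def IsWide (A : Type) [Ring A] (C : ModuleCat.{0} A → Prop) : Prop :=
  (∀ X, C X → Module.Finite A X) ∧ RespIso A C ∧
  (∀ X Y : ModuleCat.{0} A, ∀ g : ↑X →ₗ[A] ↑Y, C X → C Y →
    C (ModuleCat.of A ↥(LinearMap.ker g))) ∧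
  (∀ X Y : ModuleCat.{0} A, ∀ g : ↑X →ₗ[A] ↑Y, C X → C Y →
    C (ModuleCat.of A (↑Y ⧸ LinearMap.range g))) ∧
  (∀ X Y Z : ModuleCat.{0} A, ∀ (i : ↑X →ₗ[A] ↑Y) (q : ↑Y →ₗ[A] ↑Z),
    Injective i → Surjective q → LinearMap.range i = LinearMap.ker q →
    C X → C Z → C Y)

/-- A torsion class in the category of finitely generated `A`-modules: an
isomorphism-closed class of finitely generated modules closed under quotients and
extensions. -/
def IsTorsionClass (A : Type) [Ring A] (T : ModuleCat.{0} A → Prop) : Prop :=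
  (∀ X, T X → Module.Finite A X) ∧ RespIso A T ∧
  (∀ X Y : ModuleCat.{0} A, ∀ q : ↑X →ₗ[A] ↑Y, Surjective q → T X → T Y) ∧
  (∀ X Y Z : ModuleCat.{0} A, ∀ (i : ↑X →ₗ[A] ↑Y) (q : ↑Y →ₗ[A] ↑Z),
    Injective i → Surjective q → LinearMap.range i = LinearMap.ker q →
    T X → T Z → T Y)

/-- `X ∈ Gen C`: `X` is a quotient of a finite direct sum of modules in `C`. -/
def InGenC (A : Type) [Ring A] (C : ModuleCat.{0} A → Prop)
    (X : ModuleCat.{0} A) : Prop :=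
  ∃ (k : ℕ) (M : Fin k → ModuleCat.{0} A) (p : ((i : Fin k) → ↑(M i)) →ₗ[A] ↑X),
    (∀ i, C (M i)) ∧ Surjective p

/-- `X ∈ β(C)`: `X` is an extension of two modules lying in `Gen C`. -/
def InBeta (A : Type) [Ring A] (C : ModuleCat.{0} A → Prop)
    (X : ModuleCat.{0} A) : Prop :=
  ∃ (Y : ModuleCat.{0} A) (j : ↑Y →ₗ[A] ↑X), Injective j ∧ InGenC A C Y ∧
    InGenC A C (ModuleCat.of A (↑X ⧸ LinearMap.range j))

/-- `X ∈ α(T)`: `X ∈ T` and every morphism in `T` into `X` has kernel in `T`. -/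
def InAlpha (A : Type) [Ring A] (T : ModuleCat.{0} A → Prop)
    (X : ModuleCat.{0} A) : Prop :=
  T X ∧ ∀ (Y : ModuleCat.{0} A) (g : ↑Y →ₗ[A] ↑X), T Y →
    T (ModuleCat.of A ↥(LinearMap.ker g))

/-- `X ∈ α(T)`, testing only maps from indecomposable modules in `T`. -/
def InAlphaInd (A : Type) [Ring A] (T : ModuleCat.{0} A → Prop)
    (X : ModuleCat.{0} A) : Prop :=
  T X ∧ ∀ (Y : ModuleCat.{0} A) (g : ↑Y →ₗ[A] ↑X), T Y → Indec A Y →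
    T (ModuleCat.of A ↥(LinearMap.ker g))

/-- The coinduced module `Hom_K(A, U)`. -/
def Coind (K A U : Type) [Field K] [Ring A] [Algebra K A] [AddCommGroup U] [Module K U] : Type :=
  A →ₗ[K] U

/-- The underlying linear map. -/
def Coind.fn {K A U : Type} [Field K] [Ring A] [Algebra K A] [AddCommGroup U] [Module K U]
    (f : Coind K A U) : A →ₗ[K] U := f

section CoindSec
variable (K A U : Type) [Field K] [Ring A] [Algebra K A] [AddCommGroup U] [Module K U]

instance coindGroup : AddCommGroup (Coind K A U) :=
  inferInstanceAs (AddCommGroup (A →ₗ[K] U))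

instance coindModuleK : Module K (Coind K A U) :=
  inferInstanceAs (Module K (A →ₗ[K] U))

instance coindModule : Module A (Coind K A U) where
  smul a f := (Coind.fn f).comp (LinearMap.mulRight K a)
  one_smul f := by
    refine LinearMap.ext fun x => ?_
    exact congrArg (Coind.fn f) (mul_one x)
  mul_smul a b f := by
    refine LinearMap.ext fun x => ?_
    exact congrArg (Coind.fn f) (mul_assoc x a b).symm
  smul_zero a := by
    refine LinearMap.ext fun x => ?_
    rfl
  smul_add a f g := by
    refine LinearMap.ext fun x => ?_
    rfl
  add_smul a b f := by
    refine LinearMap.ext fun x => ?_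
    exact (congrArg (Coind.fn f) (mul_add x a b)).trans (map_add (Coind.fn f) _ _)
  zero_smul f := by
    refine LinearMap.ext fun x => ?_
    exact (congrArg (Coind.fn f) (mul_zero x)).trans (map_zero (Coind.fn f))

theorem coind_smul_apply (a : A) (f : Coind K A U) (x : A) :
    (show A →ₗ[K] U from a • f) x = (show A →ₗ[K] U from f) (x * a) := rfl

instance coindTower : IsScalarTower K A (Coind K A U) where
  smul_assoc k a f := by
    refine LinearMap.ext fun x => ?_
    change (Coind.fn f) (x * (k • a)) = k • (Coind.fn f) (x * a)
    rw [mul_smul_comm, map_smul]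

theorem coind_finite [FiniteDimensional K A] [FiniteDimensional K U] :
    Module.Finite A (Coind K A U) := by
  haveI : Module.Finite K (Coind K A U) := inferInstanceAs (Module.Finite K (A →ₗ[K] U))
  exact Module.Finite.of_restrictScalars_finite K A _

theorem coind_injective : Module.Injective A (Coind K A U) where
  out X Y _ _ _ _ i hi g := by
    letI : Module K X := Module.compHom X (algebraMap K A)
    letI : Module K Y := Module.compHom Y (algebraMap K A)
    haveI : IsScalarTower K A X := ⟨fun k a x => by
      rw [Algebra.smul_def, mul_smul]; rfl⟩
    haveI : IsScalarTower K A Y := ⟨fun k a x => by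
      rw [Algebra.smul_def, mul_smul]; rfl⟩
    obtain ⟨l, hl⟩ := LinearMap.exists_leftInverse_of_injective
      (i.restrictScalars K) (LinearMap.ker_eq_bot.2 hi)
    have hl' : ∀ x, l (i x) = x := fun x => LinearMap.congr_fun hl x
    let ev : X →ₗ[K] U :=
      { toFun := fun x => (show A →ₗ[K] U from g x) 1
        map_add' := fun x y => by rw [map_add]; rfl
        map_smul' := fun k x => by
          rw [← algebraMap_smul A k x, map_smul, coind_smul_apply, one_mul,
            Algebra.algebraMap_eq_smul_one, map_smul]; rfl }
    refine ⟨{ toFun := fun y => ((ev.comp l).comp ((LinearMap.toSpanSingleton A Y y).restrictScalars K) : A →ₗ[K] U)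
              map_add' := fun x y => ?_
              map_smul' := fun a y => ?_ }, fun x => ?_⟩
    · refine LinearMap.ext fun b => ?_
      change ev (l (b • (x + y))) = ev (l (b • x)) + ev (l (b • y))
      rw [smul_add, map_add, map_add]
    · refine LinearMap.ext fun b => ?_
      change ev (l (b • a • y)) = ev (l ((b * a) • y))
      rw [mul_smul]
    · refine LinearMap.ext fun b => ?_
      change (show A →ₗ[K] U from g (l (b • i x))) 1 = (show A →ₗ[K] U from g x) b
      rw [← map_smul i, hl', map_smul, coind_smul_apply, one_mul]

/-- The natural embedding of `U` in its coinduced module. -/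
def coindEmb [Module A U] [IsScalarTower K A U] : U →ₗ[A] Coind K A U where
  toFun u := ((LinearMap.toSpanSingleton A U u).restrictScalars K : A →ₗ[K] U)
  map_add' x y := by
    refine LinearMap.ext fun b => ?_
    exact smul_add b x y
  map_smul' a y := by
    refine LinearMap.ext fun b => ?_
    exact (mul_smul b a y).symm

theorem coindEmb_injective [Module A U] [IsScalarTower K A U] :
    Injective (coindEmb K A U) := by
  intro x y h
  have := congrArg (fun f : Coind K A U => (show A →ₗ[K] U from f) 1) h
  change (1 : A) • x = (1 : A) • y at this
  simpa using this

end CoindSec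

theorem IsUniserial.indec {A : Type} [Ring A] {M : Type} [AddCommGroup M] [Module A M]
    [Nontrivial M] (h : IsUniserial A M) : Indec A M := by
  refine ⟨inferInstance, fun X Y ⟨e⟩ => ?_⟩
  have hd : LinearMap.ker (LinearMap.fst A X Y ∘ₗ e.toLinearMap) ⊓
      LinearMap.ker (LinearMap.snd A X Y ∘ₗ e.toLinearMap) ≤ ⊥ := by
    rintro m ⟨h1, h2⟩
    have : e m = 0 := Prod.ext h1 h2
    simpa using this
  rcases h (LinearMap.ker (LinearMap.fst A X Y ∘ₗ e.toLinearMap))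
    (LinearMap.ker (LinearMap.snd A X Y ∘ₗ e.toLinearMap)) with h | h
  · right
    refine ⟨fun a b => ?_⟩
    have : e.symm (0, a - b) ∈ (⊥ : Submodule A M) := hd ⟨by simp, h (by simp)⟩
    simpa [sub_eq_zero] using this
  · left
    refine ⟨fun a b => ?_⟩
    have : e.symm (a - b, 0) ∈ (⊥ : Submodule A M) := hd ⟨h (by simp), by simp⟩
    simpa [sub_eq_zero] using this

theorem IsUniserial.of_surjective {A : Type} [Ring A] {M N : Type} [AddCommGroup M] [Module A M]
    [AddCommGroup N] [Module A N] (h : IsUniserial A M) (f : M →ₗ[A] N) (hf : Surjective f) :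
    IsUniserial A N := by
  intro U V
  rcases h (U.comap f) (V.comap f) with h | h
  · left; exact (Submodule.comap_le_comap_iff_of_surjective hf).1 h
  · right; exact (Submodule.comap_le_comap_iff_of_surjective hf).1 h

theorem IsUniserial.map {A : Type} [Ring A] {M N : Type} [AddCommGroup M] [Module A M]
    [AddCommGroup N] [Module A N] {V : Submodule A M} (h : IsUniserial A V) (f : M →ₗ[A] N) :
    IsUniserial A (V.map f) := by
  refine h.of_surjective (f.submoduleMap V) (f.submoduleMap_surjective V)

/-- The sum of all uniserial submodules. -/
def uniSup (A M : Type) [Ring A] [AddCommGroup M] [Module A M] : Submodule A M :=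
  sSup {V | IsUniserial A V}

theorem uniSup_map_le {A : Type} [Ring A] {M N : Type} [AddCommGroup M] [Module A M]
    [AddCommGroup N] [Module A N] (f : M →ₗ[A] N) : (uniSup A M).map f ≤ uniSup A N := by
  rw [Submodule.map_le_iff_le_comap]
  refine sSup_le fun V hV => ?_
  rw [← Submodule.map_le_iff_le_comap]
  exact le_sSup (IsUniserial.map hV f)

theorem enat_lt_add (a b : ℕ∞) (ha : a ≠ ⊤) (hb : b ≠ 0) : a < a + b := by
  refine lt_of_le_of_ne le_self_add fun h => hb ?_
  have h2 : a + b = a + 0 := by rw [add_zero]; exact h.symm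
  exact ENat.add_right_injective_of_ne_top ha h2

section Nak
variable {A : Type} [Ring A] [IsArtinianRing A] 

theorem exists_split_of_not_indec {M : Type} [AddCommGroup M] [Module A M] [Module.Finite A M]
    [Nontrivial M] (h : ¬ Indec A M) : ∃ X Y : ModuleCat.{0} A, Nonempty (M ≃ₗ[A] (X × Y)) ∧
      Module.Finite A X ∧ Module.Finite A Y ∧ Module.length A X < Module.length A M ∧
      Module.length A Y < Module.length A M := by
  unfold Indec at h
  push Not at h
  obtain ⟨X, Y, ⟨e⟩, hX, hY⟩ := h inferInstance
  have fX : Module.Finite A X := Module.Finite.of_surjective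
    (LinearMap.fst A X Y ∘ₗ e.toLinearMap) ((LinearMap.fst_surjective (R := A) (M := X) (M₂ := Y)).comp e.surjective)
  have fY : Module.Finite A Y := Module.Finite.of_surjective
    (LinearMap.snd A X Y ∘ₗ e.toLinearMap) ((LinearMap.snd_surjective (R := A) (M := X) (M₂ := Y)).comp e.surjective)
  have lX : Module.length A X ≠ ⊤ := Module.length_ne_top
  have lY : Module.length A Y ≠ ⊤ := Module.length_ne_top
  have pX : Module.length A X ≠ 0 := Module.length_pos.ne'
  have pY : Module.length A Y ≠ 0 := Module.length_pos.ne'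
  refine ⟨X, Y, ⟨e⟩, fX, fY, ?_, ?_⟩
  · rw [e.length_eq, Module.length_prod]
    exact enat_lt_add _ _ lX pY
  · rw [e.length_eq, Module.length_prod, add_comm]
    exact enat_lt_add _ _ lY pX

theorem uniSup_projective (hNak : IsNakayamaAlgebra A) (n : ℕ∞) :
    ∀ (M : ModuleCat.{0} A), Module.Finite A M → Module.Projective A M →
      Module.length A M = n → uniSup A M = ⊤ := by
  induction n using WellFoundedLT.induction with
  | _ n ih =>
  intro M hf hp hn
  rcases subsingleton_or_nontrivial M with hs | hs
  · exact Subsingleton.elim _ _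
  by_cases hi : Indec A M
  · refine top_le_iff.1 (le_sSup ?_)
    have := hNak.1 M hf hp hi
    exact this.of_surjective (Submodule.topEquiv.symm : M ≃ₗ[A] (⊤ : Submodule A M)).toLinearMap
      (LinearEquiv.surjective _)
  · obtain ⟨X, Y, ⟨e⟩, fX, fY, lX, lY⟩ := exists_split_of_not_indec hi
    have hpp : Module.Projective A (X × Y) := Module.Projective.of_equiv e
    have pX : Module.Projective A X := Module.Projective.of_split
      (LinearMap.inl A X Y) (LinearMap.fst A X Y) (LinearMap.fst_comp_inl A X Y)
    have pY : Module.Projective A Y := Module.Projective.of_split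
      (LinearMap.inr A X Y) (LinearMap.snd A X Y) (LinearMap.snd_comp_inr A X Y)
    have hX := ih _ (hn ▸ lX) X fX pX rfl
    have hY := ih _ (hn ▸ lY) Y fY pY rfl
    rw [eq_top_iff]
    intro m _
    have h1 : e.symm ((e m).1, 0) ∈ uniSup A M :=
      uniSup_map_le (e.symm.toLinearMap ∘ₗ LinearMap.inl A X Y)
        ⟨(e m).1, by rw [hX]; trivial, rfl⟩
    have h2 : e.symm (0, (e m).2) ∈ uniSup A M :=
      uniSup_map_le (e.symm.toLinearMap ∘ₗ LinearMap.inr A X Y)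
        ⟨(e m).2, by rw [hY]; trivial, rfl⟩
    have h3 := add_mem h1 h2
    rw [← map_add] at h3
    simpa using h3

theorem uniSup_eq_top (hNak : IsNakayamaAlgebra A) (M : Type) [AddCommGroup M] [Module A M] :
    uniSup A M = ⊤ := by
  rw [eq_top_iff]
  intro m _
  have hA : uniSup A A = ⊤ := uniSup_projective hNak _ (ModuleCat.of A A)
    (inferInstanceAs (Module.Finite A A)) (inferInstanceAs (Module.Projective A A)) rfl
  exact uniSup_map_le (LinearMap.toSpanSingleton A M m) ⟨1, by rw [hA]; trivial, by simp⟩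

theorem exists_uniserial_injective (hNak : IsNakayamaAlgebra A) {U : Type} [AddCommGroup U]
    [Module A U] (hU : IsUniserial A U) (n : ℕ∞) :
    ∀ (M : ModuleCat.{0} A) (j : U →ₗ[A] M), Injective j → Module.Finite A M →
      Module.Injective A M → Module.length A M = n →
      ∃ (E : ModuleCat.{0} A) (j : U →ₗ[A] E), Injective j ∧ Module.Finite A E ∧
        Module.Injective A E ∧ IsUniserial A E := by
  induction n using WellFoundedLT.induction with
  | _ n ih =>
  intro M j hj hf hp hn
  rcases subsingleton_or_nontrivial M with hs | hs
  · exact ⟨M, j, hj, hf, hp, fun V W => Or.inl (le_of_eq (Subsingleton.elim _ _))⟩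
  by_cases hi : Indec A M
  · exact ⟨M, j, hj, hf, hp, hNak.2 M hf hp hi⟩
  · obtain ⟨X, Y, ⟨e⟩, fX, fY, lX, lY⟩ := exists_split_of_not_indec hi
    have pX : Module.Injective A X := ⟨fun P Q _ _ _ _ i hi g => by
      obtain ⟨h, hh⟩ := hp.out i hi (e.symm.toLinearMap ∘ₗ LinearMap.inl A X Y ∘ₗ g)
      exact ⟨LinearMap.fst A X Y ∘ₗ e.toLinearMap ∘ₗ h, fun x => by simp [hh]⟩⟩
    have pY : Module.Injective A Y := ⟨fun P Q _ _ _ _ i hi g => by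
      obtain ⟨h, hh⟩ := hp.out i hi (e.symm.toLinearMap ∘ₗ LinearMap.inr A X Y ∘ₗ g)
      exact ⟨LinearMap.snd A X Y ∘ₗ e.toLinearMap ∘ₗ h, fun x => by simp [hh]⟩⟩
    let j1 := LinearMap.fst A X Y ∘ₗ e.toLinearMap ∘ₗ j
    let j2 := LinearMap.snd A X Y ∘ₗ e.toLinearMap ∘ₗ j
    have hd : ∀ u, j1 u = 0 → j2 u = 0 → u = 0 := by
      intro u h1 h2
      have : e (j u) = 0 := Prod.ext h1 h2
      exact hj (by simpa using this)
    rcases hU (LinearMap.ker j1) (LinearMap.ker j2) with h | h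
    · refine ih _ (hn ▸ lX) X j1 ?_ fX pX rfl
      exact (injective_iff_map_eq_zero _).2 fun u hu => hd u hu (h hu)
    · refine ih _ (hn ▸ lY) Y j2 ?_ fY pY rfl
      exact (injective_iff_map_eq_zero _).2 fun u hu => hd u (h hu) hu

theorem range_le_of_length (hNak : IsNakayamaAlgebra A) {M E : Type} [AddCommGroup M] [Module A M]
    [AddCommGroup E] [Module A E] [Module.Finite A E] (hE : IsUniserial A E) (d : ℕ∞)
    (hd : ∀ V : Submodule A M, IsUniserial A V → Module.length A V ≤ d)
    (W : Submodule A E) (hW : d ≤ Module.length A W) (f : M →ₗ[A] E) :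
    LinearMap.range f ≤ W := by
  rw [LinearMap.range_eq_map, ← uniSup_eq_top hNak M, Submodule.map_le_iff_le_comap]
  refine sSup_le fun V hV => ?_
  rw [← Submodule.map_le_iff_le_comap]
  rcases hE (V.map f) W with h | h
  · exact h
  · have h1 : Module.length A (V.map f) ≤ Module.length A W :=
      (Module.length_le_of_surjective (f.submoduleMap V) (f.submoduleMap_surjective V)).trans
        ((hd V hV).trans hW)
    rw [Module.length_submodule, Module.length_submodule] at h1
    by_contra hc
    have hlt : W < V.map f := lt_of_le_of_ne h (fun he => hc he.ge)
    exact absurd (Submodule.height_strictMono hlt) (not_lt.2 h1)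

theorem exists_max_uniserial (hNak : IsNakayamaAlgebra A) (M : Type) [AddCommGroup M] [Module A M]
    [Module.Finite A M] [Nontrivial M] : ∃ U : Submodule A M, IsUniserial A U ∧ Nontrivial U ∧
      ∀ V : Submodule A M, IsUniserial A V → Module.length A V ≤ Module.length A U := by
  obtain ⟨V0, hV0, hn⟩ : ∃ V : Submodule A M, IsUniserial A V ∧ V ≠ ⊥ := by
    by_contra hc
    push Not at hc
    have : uniSup A M ≤ ⊥ := sSup_le fun V hV => (hc V hV).le
    rw [uniSup_eq_top hNak] at this
    exact absurd (le_bot_iff.1 this) top_ne_bot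
  obtain ⟨U, hU, hmax⟩ := WellFounded.has_min
    (r := fun V W : Submodule A M => Module.length A W < Module.length A V)
    (by
      refine Subrelation.wf (r := fun V W : Submodule A M => Module.length A M - Module.length A V < Module.length A M - Module.length A W) ?_ (InvImage.wf (fun V : Submodule A M => Module.length A M - Module.length A V) wellFounded_lt)
      intro V W h
      have hM : Module.length A M ≠ ⊤ := Module.length_ne_top
      have hV : Module.length A V ≤ Module.length A M :=
        Module.length_le_of_injective V.subtype V.subtype_injective
      generalize Module.length A M = a at *
      generalize Module.length A V = b at *
      generalize Module.length A W = c at *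
      lift a to ℕ using hM
      lift b to ℕ using ne_top_of_le_ne_top (by simp) hV
      lift c to ℕ using h.ne_top
      norm_cast at *
      omega)
    {V | IsUniserial A V} ⟨V0, hV0⟩
  have hm : ∀ V : Submodule A M, IsUniserial A V → Module.length A V ≤ Module.length A U :=
    fun V hV => not_lt.1 (hmax V hV)
  refine ⟨U, hU, ?_, hm⟩
  haveI := Submodule.nontrivial_iff_ne_bot.2 hn
  exact Module.length_pos_iff.1 (Module.length_pos.trans_le (hm V0 hV0))

end Nak

theorem exists_uniserial_hull (K A : Type) [Field K] [Ring A] [Algebra K A]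
    [FiniteDimensional K A] [IsArtinianRing A] (hNak : IsNakayamaAlgebra A) (U : Type)
    [AddCommGroup U] [Module A U] [Module.Finite A U] (hU : IsUniserial A U) :
    ∃ (E : ModuleCat.{0} A) (j : U →ₗ[A] E), Injective j ∧ Module.Finite A E ∧
        Module.Injective A E ∧ IsUniserial A E := by
  letI : Module K U := Module.compHom U (algebraMap K A)
  haveI : IsScalarTower K A U := ⟨fun k a x => by
      rw [Algebra.smul_def, mul_smul]; rfl⟩
  haveI : Module.Finite K U := Module.Finite.trans A U
  exact exists_uniserial_injective hNak hU _ (ModuleCat.of A (Coind K A U)) (coindEmb K A U)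
    (coindEmb_injective K A U) (coind_finite K A U) (coind_injective K A U) rfl

theorem alpha_aux (K A : Type) [Field K] [Ring A] [Algebra K A]
    [FiniteDimensional K A] [IsArtinianRing A] (hNak : IsNakayamaAlgebra A)
    (T : ModuleCat.{0} A → Prop) (hT : IsTorsionClass A T) (X : ModuleCat.{0} A)
    (hX : InAlphaInd A T X) (n : ℕ∞) :
    ∀ (Y : ModuleCat.{0} A) (g : ↑Y →ₗ[A] ↑X), T Y → Module.length A Y = n →
    T (ModuleCat.of A ↥(LinearMap.ker g)) := by
  obtain ⟨hTf, hTi, hTq, hTe⟩ := hT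
  induction n using WellFoundedLT.induction with
  | _ n ih =>
  intro Y g hY hn
  haveI := hTf Y hY
  rcases subsingleton_or_nontrivial Y with hs | hs
  · exact hTq Y (ModuleCat.of A (LinearMap.ker g)) 0 (fun y => ⟨0, Subsingleton.elim _ _⟩) hY
  obtain ⟨U, hU, hUn, hmax⟩ := exists_max_uniserial hNak Y
  obtain ⟨E, j, hj, hEf, hEi, hE⟩ := exists_uniserial_hull K A hNak U hU
  have hlen : Module.length A U ≤ Module.length A (LinearMap.range j) :=
    (LinearEquiv.ofInjective j hj).length_eq.le
  -- the retraction onto `U`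
  have key : ∀ f : Y →ₗ[A] E, ∃ r : Y →ₗ[A] U, ∀ y, j (r y) = f y := by
    intro f
    have h := range_le_of_length hNak hE _ hmax (LinearMap.range j) hlen f
    refine ⟨(LinearEquiv.ofInjective j hj).symm.toLinearMap ∘ₗ
      f.codRestrict (LinearMap.range j) (fun y => h ⟨y, rfl⟩), fun y => ?_⟩
    have := (LinearEquiv.ofInjective j hj).apply_symm_apply
      (f.codRestrict (LinearMap.range j) (fun y => h ⟨y, rfl⟩) y)
    exact congrArg Subtype.val this
  obtain ⟨f0, hf0⟩ := hEi.out U.subtype U.subtype_injective j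
  obtain ⟨r, hr⟩ := key f0
  have hrU : ∀ u : U, r u = u := fun u => hj ((hr u).trans (hf0 u))
  have hTU : T (ModuleCat.of A U) := hTq Y (ModuleCat.of A U) r (fun u => ⟨u, hrU u⟩) hY
  let gU : U →ₗ[A] X := g ∘ₗ U.subtype
  have hN : T (ModuleCat.of A (LinearMap.ker gU)) := hX.2 (ModuleCat.of A U) gU hTU hU.indec
  by_cases hb : LinearMap.ker gU = ⊥
  · -- the kernel meets `U` trivially
    let q : Y →ₗ[A] LinearMap.ker r := (LinearMap.id - U.subtype ∘ₗ r).codRestrict (LinearMap.ker r)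
      (fun y => by simp [hrU])
    have hq : ∀ y, (q y : Y) = y - r y := fun y => rfl
    have hqs : ∀ y : LinearMap.ker r, q y = y := fun y => by
      apply Subtype.ext
      rw [hq, LinearMap.mem_ker.1 y.2]; simp
    have hTr : T (ModuleCat.of A (LinearMap.ker r)) :=
      hTq Y (ModuleCat.of A (LinearMap.ker r)) q (fun y => ⟨y, hqs y⟩) hY
    have hqi : Injective (q ∘ₗ (LinearMap.ker g).subtype) := by
      refine (injective_iff_map_eq_zero _).2 fun y hy => ?_
      have h1 : (y : Y) = r y := by
        have := congrArg Subtype.val hy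
        exact sub_eq_zero.1 this
      have h2 : r y ∈ LinearMap.ker gU := by
        change g (r y) = 0
        rw [← h1]; exact y.2
      rw [hb, Submodule.mem_bot] at h2
      apply Subtype.ext
      rw [h1, h2]; rfl
    obtain ⟨f1, hf1⟩ := hEi.out _ hqi (j ∘ₗ r ∘ₗ (LinearMap.ker g).subtype)
    obtain ⟨f2, hf2⟩ := key (f1 ∘ₗ q)
    have hf2' : ∀ i ∈ LinearMap.ker g, f2 (q i) = r i := fun i hi => by
      apply hj
      rw [hf2]
      have := hf1 ⟨i, hi⟩
      simp only [LinearMap.comp_apply, Submodule.subtype_apply] at this ⊢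
      rw [hqs, this]
    let m : LinearMap.ker r →ₗ[A] Y :=
      (LinearMap.ker r).subtype + U.subtype ∘ₗ f2 ∘ₗ (LinearMap.ker r).subtype
    have hm : ∀ i ∈ LinearMap.ker g, m (q i) = i := fun i hi => by
      change (q i : Y) + (f2 (q i) : Y) = i
      rw [hf2' i hi, hq]; simp
    have hlt : Module.length A (LinearMap.ker r) < n := by
      rw [← hn]
      apply Submodule.length_lt
      intro ht
      obtain ⟨u, hu⟩ := exists_ne (0 : U)
      apply hu
      rw [← hrU u]
      exact LinearMap.mem_ker.1 (ht ▸ Submodule.mem_top)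
    have hk := ih _ hlt (ModuleCat.of A (LinearMap.ker r)) (g ∘ₗ m) hTr rfl
    refine hTq _ (ModuleCat.of A (LinearMap.ker g))
      (m.restrict (p := LinearMap.ker (g ∘ₗ m)) (q := LinearMap.ker g) (fun x hx => hx)) ?_ hk
    rintro ⟨i, hi⟩
    refine ⟨⟨q i, ?_⟩, ?_⟩
    · change g (m (q i)) = 0
      rw [hm i hi]; exact hi
    · exact Subtype.ext (hm i hi)
  · -- pass to the quotient
    let N : Submodule A Y := (LinearMap.ker gU).map U.subtype
    have hNg : N ≤ LinearMap.ker g := by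
      rintro _ ⟨u, hu, rfl⟩
      exact hu
    have hNb : N ≠ ⊥ := fun h => hb (Submodule.map_injective_of_injective
      U.subtype_injective (h.trans (Submodule.map_bot _).symm))
    have hTN : T (ModuleCat.of A N) := hTi _ _
      ⟨Submodule.equivMapOfInjective U.subtype U.subtype_injective (LinearMap.ker gU)⟩ hN
    have hTQ : T (ModuleCat.of A (Y ⧸ N)) := hTq Y (ModuleCat.of A (Y ⧸ N)) N.mkQ
      N.mkQ_surjective hY
    have hlt : Module.length A (Y ⧸ N) < n := hn ▸ Submodule.length_quotient_lt N hNb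
    have hk := ih _ hlt (ModuleCat.of A (Y ⧸ N)) (N.liftQ g hNg) hTQ rfl
    refine hTe (ModuleCat.of A N) (ModuleCat.of A (LinearMap.ker g)) _
      (Submodule.inclusion hNg)
      (N.mkQ.restrict (p := LinearMap.ker g) (q := LinearMap.ker (N.liftQ g hNg))
        (fun x hx => by simpa using hx))
      (Submodule.inclusion_injective hNg) ?_ ?_ hTN hk
    · rintro ⟨z, hz⟩
      obtain ⟨y, rfl⟩ := N.mkQ_surjective z
      exact ⟨⟨y, by simpa using hz⟩, rfl⟩
    · ext ⟨y, hy⟩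
      rw [Submodule.range_inclusion, LinearMap.mem_ker]
      constructor
      · intro h
        exact Subtype.ext ((Submodule.Quotient.mk_eq_zero N).2 h)
      · intro h
        exact (Submodule.Quotient.mk_eq_zero N).1 (congrArg Subtype.val h)

/-- Let `A` be a Nakayama algebra and `T` a torsion class of finitely
generated `A`-modules.  Then `α(T)` coincides with the a priori larger class obtained by
testing only morphisms from indecomposable modules of `T`. -/
theorem alpha_eq_alpha_indec
    (K A : Type) [Field K] [IsAlgClosed K] [Ring A] [Algebra K A] [FiniteDimensional K A]
    (hNak : IsNakayamaAlgebra A)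
    (T : ModuleCat.{0} A → Prop) (hT : IsTorsionClass A T) :
    ∀ X : ModuleCat.{0} A, InAlpha A T X ↔ InAlphaInd A T X := by
  intro X
  haveI : IsArtinianRing A := IsArtinianRing.of_finite K A
  exact ⟨fun h => ⟨h.1, fun Y g hY _ => h.2 Y g hY⟩,
    fun h => ⟨h.1, fun Y g hY => alpha_aux K A hNak T hT X h _ Y g hY rfl⟩⟩

end
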